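/- Let Γ[ℓ] denote the level-ℓ congruence subgroup of Sp(2g, ℤ). For positive integers ℓ and m, the product set Γ[ℓ] · Γ[m] equals Γ[gcd(ℓ, m)]. -/

import Mathlib

open Matrix Pointwise

/-- Reduction of an integral symplectic matrix modulo `ℓ`, as a map to the units of the
matrix ring over `ZMod ℓ`. -/
noncomputable def spMod (g ℓ : ℕ) :
    Matrix.symplecticGroup (Fin g) ℤ →* (Matrix (Fin g ⊕ Fin g) (Fin g ⊕ Fin g) (ZMod ℓ))ˣ :=
  MonoidHom.toHomUnits
    (((Int.castRingHom (ZMod ℓ)).mapMatrix.toMonoidHom).comp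
      (Matrix.symplecticGroup (Fin g) ℤ).subtype)

/-- The level-`ℓ` congruence subgroup `Γ[ℓ]` of `Sp(2g, ℤ)`: the kernel of reduction mod `ℓ`. -/
noncomputable def spCong (g ℓ : ℕ) : Subgroup (Matrix.symplecticGroup (Fin g) ℤ) :=
  (spMod g ℓ).ker

instance spCong_normal (g ℓ : ℕ) : (spCong g ℓ).Normal := MonoidHom.normal_ker _

theorem exists_symmetric_X_invertible_add_mul_of_ker_inter_eq_bot {l : Type*} [DecidableEq l] [Fintype l] {R : Type*} [Field R]
    {A C : Matrix l l R} (hker : ∀ (x : l → R), (A • x = 0) → (C • x = 0) → x = 0)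
    (hsymm : Aᵀ * C = Cᵀ * A) :
    ∃ (X : Matrix l l R), X.IsSymm ∧ IsUnit (A + X * C) := by
  -- `C` is transformed into `P = fromBlocks 1 0 0 0` by invertible matrices `V` and `U`.
  rcases exists_rank_normal_form C with ⟨V, U, s, hV, hU, heq⟩
  set P := V * C * U with P_def; set Q := Vᵀ⁻¹ * A * U with Q_def
  set f := fun (x : Matrix l l R) ↦ x.submatrix s.symm s.symm
  have hf (x) : f x = x.submatrix s.symm s.symm := rfl
  have f_unit {x} : IsUnit x → IsUnit (f x) := (isUnit_submatrix_equiv ..).2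
  have f_mul (x y) : f (x * y) = f x * f y := submatrix_mul _ _ _ _ _ s.symm.bijective
  have _ : Invertible V := hV.invertible
  have _ : Invertible U := hU.invertible
  have _ : Invertible (f Vᵀ) := (f_unit (V.isUnit_transpose.2 hV)).invertible
  -- The hypothesis that the only vector annihilated by both matrices is 0, holds for `P` and `Q`.
  have con1 (x : Fin C.rank ⊕ Fin (Fintype.card l - C.rank) → R)
      (heq1 : (f Q) • x = 0) (heq2 : (f P) • x = 0) : x = 0 := by
    refine (f_unit hU).smul_left_cancel.1 ?_
    rw [f_mul, f_mul, mul_assoc, mul_smul, IsUnit.smul_eq_zero, mul_smul, hf,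
      smul_eq_mulVec, submatrix_mulVec_equiv, Equiv.symm_symm] at heq1 heq2
    · rw [Equiv.comp_symm_eq, Pi.zero_comp] at heq1 heq2
      exact s.surjective.injective_comp_right <| by simpa using hker _ heq1 heq2
    · exact f_unit hV
    · exact f_unit <| isUnit_nonsing_inv_iff.2 <| V.isUnit_transpose.2 hV
  -- The symmetry relation also holds for `P` and `Q`.
  have con2 : Qᵀ * P = Pᵀ * Q := by
    simp only [P_def, mul_assoc, transpose_mul, transpose_nonsing_inv, transpose_transpose, Q_def,
      inv_mul_cancel_left_of_invertible, mul_inv_cancel_left_of_invertible]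
    rw [← mul_assoc Aᵀ, hsymm, mul_assoc]
  replace con2 : (f Q).toBlocks₁₁ᵀ = (f Q).toBlocks₁₁ ∧ (f Q).toBlocks₁₂ = 0 := by
    apply_fun reindex s s at con2
    rw [reindex_apply, reindex_apply, ← hf, ← hf, f_mul, f_mul Pᵀ, heq, hf,
      ← transpose_submatrix, ← hf Q, ← (f Q).fromBlocks_toBlocks, hf (_)ᵀ, hf
      ((fromBlocks 1 0 0 0).submatrix _ _)] at con2
    simp [fromBlocks_transpose, fromBlocks_multiply] at con2; tauto
  -- The lower-right block of `Q` is invertible.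
  have con3 : IsUnit (f Q).toBlocks₂₂ := by
    refine mulVec_injective_iff_isUnit.1 ?_
    rw [← coe_mulVecLin, ← LinearMap.ker_eq_bot]
    refine ker_mulVecLin_eq_bot_iff.2 fun x hx ↦ Sum.elim_injective' <|
      (con1 _ ?_ ?_).trans Sum.elim_zero_zero.symm
    · rw [← (f Q).fromBlocks_toBlocks]; simp [hx, con2.2, fromBlocks_mulVec]
    · simp [hf, heq, fromBlocks_mulVec]
  set Y : Matrix (Fin C.rank ⊕ Fin (Fintype.card l - C.rank)) (Fin C.rank ⊕
    Fin (Fintype.card l - C.rank)) R := fromBlocks (1 - (f Q).toBlocks₁₁) 0 0 0 with Y_def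
  have hY_symm : Y.IsSymm := by
    rw [Y_def, isSymm_fromBlocks_iff]
    exact ⟨IsSymm.sub isSymm_one con2.1, by simp⟩
  -- We now take `X = Vᵀ * Y * V` and this gives the desired matrix `X.submatrix s s`.
  set X := (f Vᵀ) * Y * (f V) with X_def
  refine ⟨X.submatrix s s, IsSymm.submatrix ?_ s, (isUnit_submatrix_equiv s.symm s.symm).1 ?_⟩
  · simp_rw [X_def, Matrix.IsSymm, transpose_mul, hY_symm.eq, hf, transpose_submatrix,
      transpose_transpose, mul_assoc]
  · have heq' : f (A + X.submatrix s s * C) = (f Vᵀ) * (f Q + Y * (f P)) * f (U⁻¹) := by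
      simp_rw [hf, submatrix_add, Pi.add_apply, Q_def, P_def, ← hf, f_mul, hf, mul_add, ← mul_assoc,
        ← inv_submatrix_equiv, add_mul, mul_assoc _ (U.submatrix _ _), mul_inv_of_invertible]
      simp [X_def]; rfl
    rw [← hf, heq', IsUnit.mul_iff, IsUnit.mul_iff]
    refine ⟨⟨isUnit_of_invertible _, ?_⟩, ?_⟩
    · nth_rw 1 [Y_def, heq, ← (f Q).fromBlocks_toBlocks, con2.2]
      simpa [hf, fromBlocks_multiply, fromBlocks_add]
    · exact f_unit <| isUnit_nonsing_inv_iff.2 hU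

theorem int_smith {l : Type*} [DecidableEq l] [Fintype l] (A : Matrix l l ℤ) (h : A.det ≠ 0) :
    ∃ (U U' V V' : Matrix l l ℤ) (a : l → ℤ), U * U' = 1 ∧ V * V' = 1 ∧
      A = U * diagonal a * V := by
  have hinj : Function.Injective (Matrix.toLin' A) := by
    have := Matrix.mulVec_injective_iff_isUnit (A := A.map (Int.castRingHom ℚ))
    rw [injective_iff_map_eq_zero]
    intro v hv
    exact Matrix.eq_zero_of_mulVec_eq_zero h (by simpa using hv)
  let e := LinearEquiv.ofInjective (Matrix.toLin' A) hinj
  obtain ⟨bM, a, bN, hab⟩ := Submodule.exists_smith_normal_form_of_rank_eq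
    (Pi.basisFun ℤ l) (N := LinearMap.range (Matrix.toLin' A)) e.symm.finrank_eq
  let s := Pi.basisFun ℤ l
  refine ⟨s.toMatrix bM, bM.toMatrix s, LinearMap.toMatrix s bN e.toLinearMap,
    LinearMap.toMatrix bN s e.symm.toLinearMap, a, ?_, ?_, ?_⟩
  · exact Module.Basis.toMatrix_mul_toMatrix_flip _ _
  · rw [← LinearMap.toMatrix_comp]
    simp
  · have h1 : LinearMap.toMatrix bN bM (Submodule.subtype _) = diagonal a := by
      ext i j
      rw [LinearMap.toMatrix_apply, Submodule.subtype_apply, hab, map_smul, Finsupp.smul_apply,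
        Module.Basis.repr_self, Finsupp.single_apply, diagonal_apply]
      by_cases hij : i = j
      · subst hij; simp
      · simp [hij, Ne.symm hij]
    rw [← h1, mul_assoc, ← LinearMap.toMatrix_comp, ← LinearMap.toMatrix_id_eq_basis_toMatrix,
      ← LinearMap.toMatrix_comp]
    have : (LinearMap.id ∘ₗ Submodule.subtype _ ∘ₗ e.toLinearMap) = Matrix.toLin' A := by
      ext; simp [e]
    rw [this]
    change A = LinearMap.toMatrix' _
    simp

section lift
variable {l : Type*} [DecidableEq l] [Fintype l] (n : ℕ) [NeZero n]

/-- Matrices mod `n` which are reductions of integral symplectic matrices. -/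
def spImg (l : Type*) [DecidableEq l] [Fintype l] (n : ℕ) :
    Submonoid (Matrix (l ⊕ l) (l ⊕ l) (ZMod n)) :=
  (symplecticGroup l ℤ).map (Int.castRingHom (ZMod n)).mapMatrix.toMonoidHom

theorem spImg_of {l : Type*} [DecidableEq l] [Fintype l] {n : ℕ} {A B C D : Matrix l l ℤ}
    (h : fromBlocks A B C D ∈ symplecticGroup l ℤ) {A' B' C' D' : Matrix l l (ZMod n)}
    (hA : A.map (Int.castRingHom (ZMod n)) = A') (hB : B.map (Int.castRingHom (ZMod n)) = B')
    (hC : C.map (Int.castRingHom (ZMod n)) = C') (hD : D.map (Int.castRingHom (ZMod n)) = D') :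
    fromBlocks A' B' C' D' ∈ spImg l n := by
  refine ⟨_, h, ?_⟩
  subst hA hB hC hD
  exact fromBlocks_map _ _ _ _ _

theorem exists_lift (X : Matrix l l (ZMod n)) :
    ∃ Y : Matrix l l ℤ, Y.map (Int.castRingHom (ZMod n)) = X ∧ (X.IsSymm → Y.IsSymm) := by
  refine ⟨X.map (fun a => (a.val : ℤ)), ?_, fun h => h.map _⟩
  ext i j
  simp

theorem upper_mem {X : Matrix l l (ZMod n)} (hX : X.IsSymm) :
    fromBlocks 1 X 0 1 ∈ spImg l n := by
  obtain ⟨Y, hY, hs⟩ := exists_lift n X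
  refine spImg_of (A := 1) (B := Y) (C := 0) (D := 1) ?_ (by simp) hY (by simp) (by simp)
  rw [SymplecticGroup.fromBlocks_mem_iff]
  simp [(hs hX).eq]

theorem lower_mem {X : Matrix l l (ZMod n)} (hX : X.IsSymm) :
    fromBlocks 1 0 X 1 ∈ spImg l n := by
  obtain ⟨Y, hY, hs⟩ := exists_lift n X
  refine spImg_of (A := 1) (B := 0) (C := Y) (D := 1) ?_ (by simp) (by simp) hY (by simp)
  rw [SymplecticGroup.fromBlocks_mem_iff]
  simp [(hs hX).eq]

theorem levi_symm_mem {S T : Matrix l l (ZMod n)} (hS : S.IsSymm) (hT : T.IsSymm)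
    (h : S * T = 1) : fromBlocks S 0 0 T ∈ spImg l n := by
  have h' : T * S = 1 := mul_eq_one_comm.1 h
  have w1 := mul_mem (mul_mem (upper_mem n hS) (lower_mem n hT.neg)) (upper_mem n hS)
  have i1 : (1 : Matrix l l (ZMod n)).IsSymm := isSymm_one
  have w2 := mul_mem (mul_mem (upper_mem n i1.neg) (lower_mem n i1)) (upper_mem n i1.neg)
  have := mul_mem w1 w2
  simpa [fromBlocks_multiply, h, h'] using this

theorem levi_int_mem {U V : Matrix l l ℤ} (h : U * V = 1) :
    fromBlocks (U.map (Int.castRingHom (ZMod n))) 0 0 (Vᵀ.map (Int.castRingHom (ZMod n)))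
      ∈ spImg l n := by
  refine spImg_of (A := U) (B := 0) (C := 0) (D := Vᵀ) ?_ rfl (by simp) (by simp) rfl
  rw [SymplecticGroup.fromBlocks_mem_iff]
  simp [← transpose_mul, mul_eq_one_comm.1 h]

theorem levi_mem {A B : Matrix l l (ZMod n)} (h : A * B = 1) :
    fromBlocks A 0 0 Bᵀ ∈ spImg l n := by
  rcases subsingleton_or_nontrivial (ZMod n) with hs | hn
  · have e : fromBlocks A 0 0 Bᵀ = 1 := by
      ext i j
      exact Subsingleton.elim _ _
    rw [e]
    exact one_mem _
  obtain ⟨Y, hY, -⟩ := exists_lift n A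
  have hu : IsUnit A.det := by
    rw [← Matrix.isUnit_iff_isUnit_det]
    exact IsUnit.of_mul_eq_one _ h
  have hdet : (Int.castRingHom (ZMod n)) Y.det = A.det := by
    rw [RingHom.map_det, RingHom.mapMatrix_apply, hY]
  have hY0 : Y.det ≠ 0 := by
    intro h0
    rw [h0, map_zero] at hdet
    exact hu.ne_zero hdet.symm
  obtain ⟨U, U', V, V', a, hU, hV, hA⟩ := int_smith Y hY0
  let φ := (Int.castRingHom (ZMod n)).mapMatrix (m := l)
  have hU1 : φ U * φ U' = 1 := by rw [← map_mul, hU, map_one]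
  have hV1 : φ V * φ V' = 1 := by rw [← map_mul, hV, map_one]
  have hU2 := mul_eq_one_comm.1 hU1
  have hV2 := mul_eq_one_comm.1 hV1
  let d : Matrix l l (ZMod n) := diagonal (fun i => (a i : ZMod n))
  have hd : φ (diagonal a) = d := by
    simp [φ, d]
  have hA2 : A = φ U * d * φ V := by
    rw [← hd, ← map_mul, ← map_mul, ← hA]; exact hY.symm
  have hprod : IsUnit d.det := by
    rw [hA2, det_mul, det_mul] at hu
    exact isUnit_of_mul_isUnit_right (isUnit_of_mul_isUnit_left hu)
  have hds : d.IsSymm := isSymm_diagonal _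
  have hdi : d * d⁻¹ = 1 := Matrix.mul_nonsing_inv _ hprod
  have hdis : d⁻¹.IsSymm := by
    rw [Matrix.IsSymm, Matrix.transpose_nonsing_inv, hds.eq]
  have := mul_mem (mul_mem (levi_int_mem n hU) (levi_symm_mem n hds hdis hdi)) (levi_int_mem n hV)
  convert this using 1
  have hB : B = φ V' * d⁻¹ * φ U' := by
    have : A * (φ V' * d⁻¹ * φ U') = 1 := by
      rw [hA2]
      calc _ = φ U * (d * (φ V * φ V') * d⁻¹) * φ U' := by simp only [mul_assoc]
        _ = 1 := by rw [hV1, mul_one, hdi, mul_one, hU1]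
    exact (left_inv_eq_right_inv (mul_eq_one_comm.1 h) this)
  simp only [fromBlocks_multiply]
  rw [hB, hA2]
  simp [φ, hdis.eq, transpose_mul, mul_assoc, transpose_map]

theorem mem_of_isUnit {A B C D : Matrix l l (ZMod n)}
    (h : fromBlocks A B C D ∈ symplecticGroup l (ZMod n)) (hA : IsUnit A.det) :
    fromBlocks A B C D ∈ spImg l n := by
  have h1 : A * A⁻¹ = 1 := Matrix.mul_nonsing_inv _ hA
  have h2 : A⁻¹ * A = 1 := Matrix.nonsing_inv_mul _ hA
  have h1t : A⁻¹ᵀ * Aᵀ = 1 := by rw [← transpose_mul, h1, transpose_one]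
  have h2t : Aᵀ * A⁻¹ᵀ = 1 := by rw [← transpose_mul, h2, transpose_one]
  have hb := SymplecticGroup.fromBlocks_mem_iff.1 h
  have hCA : (C * A⁻¹).IsSymm := by
    rw [Matrix.IsSymm, transpose_mul]
    calc A⁻¹ᵀ * Cᵀ = A⁻¹ᵀ * (Cᵀ * A) * A⁻¹ := by rw [mul_assoc, mul_assoc, h1, mul_one]
      _ = C * A⁻¹ := by rw [← hb.1, ← mul_assoc, h1t, one_mul]
  have hlow : fromBlocks 1 0 (-(C * A⁻¹)) 1 ∈ symplecticGroup l (ZMod n) := by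
    rw [SymplecticGroup.fromBlocks_mem_iff]
    have := hCA.neg.eq
    simp_all
  have h3 := mul_mem hlow h
  have e3 : fromBlocks 1 0 (-(C * A⁻¹)) 1 * fromBlocks A B C D =
      fromBlocks A B 0 (D - C * A⁻¹ * B) := by
    simp [fromBlocks_multiply, mul_assoc, h2, sub_eq_add_neg, add_comm]
  rw [e3, SymplecticGroup.fromBlocks_mem_iff] at h3
  obtain ⟨-, h4, h5⟩ := h3
  have h6 : D - C * A⁻¹ * B = A⁻¹ᵀ := by
    have h5' : Aᵀ * (D - C * A⁻¹ * B) = 1 := by simpa using h5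
    exact (left_inv_eq_right_inv h1t h5').symm
  rw [h6] at h4
  have hAB : (A⁻¹ * B).IsSymm := by
    rw [Matrix.IsSymm, transpose_mul, h4, transpose_transpose]
  have := mul_mem (mul_mem (lower_mem n hCA) (levi_mem n h1)) (upper_mem n hAB)
  convert this using 1
  simp only [fromBlocks_multiply]
  have e1 : A * (A⁻¹ * B) = B := by rw [← mul_assoc, h1, one_mul]
  have e2 : C * A⁻¹ * A = C := by rw [mul_assoc, h2, mul_one]
  have e4 : D = C * (A⁻¹ * B) + A⁻¹ᵀ := by rw [← h6, mul_assoc]; abel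
  simp only [one_mul, mul_one, zero_mul, mul_zero, add_zero, zero_add, e1, e2, ← e4]

theorem exists_crt_symm (X : ∀ p : ℕ, Matrix l l (ZMod p)) (hX : ∀ p, (X p).IsSymm) :
    ∃ Y : Matrix l l ℤ, Y.IsSymm ∧ ∀ p ∈ n.primeFactors,
      Y.map (Int.castRingHom (ZMod p)) = X p := by
  have key : ∀ a : (∀ p : ℕ, ZMod p), ∃ y : ℤ, ∀ p ∈ n.primeFactors, (y : ZMod p) = a p := by
    intro a
    let k := Nat.chineseRemainderOfFinset (fun p => (a p).val) id n.primeFactors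
      (fun p hp => (Nat.prime_of_mem_primeFactors hp).ne_zero)
      (fun p hp q hq hpq => (Nat.coprime_primes (Nat.prime_of_mem_primeFactors hp)
        (Nat.prime_of_mem_primeFactors hq)).2 hpq)
    refine ⟨(k.1 : ℤ), fun p hp => ?_⟩
    have h1 := k.2 p hp
    have : NeZero p := ⟨(Nat.prime_of_mem_primeFactors hp).ne_zero⟩
    have h2 := (ZMod.natCast_eq_natCast_iff _ _ _).2 h1
    simpa using h2
  choose f hf using key
  refine ⟨fun i j => f (fun p => X p i j), ?_, fun p hp => ?_⟩
  · ext i j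
    change f (fun p => X p j i) = f (fun p => X p i j)
    congr 1
    funext p
    exact (hX p).apply i j
  · ext i j
    exact hf _ p hp

theorem exists_good_X {A B C D : Matrix l l (ZMod n)}
    (h : fromBlocks A B C D ∈ symplecticGroup l (ZMod n)) :
    ∃ X : Matrix l l (ZMod n), X.IsSymm ∧ IsUnit (A + X * C).det := by
  have hloc : ∀ p : ℕ, ∃ X : Matrix l l (ZMod p), X.IsSymm ∧
      ∀ hp : p ∈ n.primeFactors, IsUnit
        (A.map (ZMod.castHom (Nat.dvd_of_mem_primeFactors hp) (ZMod p)) +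
          X * C.map (ZMod.castHom (Nat.dvd_of_mem_primeFactors hp) (ZMod p))) := by
    intro p
    by_cases hp : p ∈ n.primeFactors
    swap
    · exact ⟨0, isSymm_zero, fun h => absurd h hp⟩
    have : Fact p.Prime := ⟨Nat.prime_of_mem_primeFactors hp⟩
    let f := ZMod.castHom (Nat.dvd_of_mem_primeFactors hp) (ZMod p)
    have hm := SymplecticGroup.map_mem h f
    rw [fromBlocks_map, SymplecticGroup.fromBlocks_mem_iff] at hm
    have hu := (Matrix.isUnit_iff_isUnit_det _).2
      (SymplecticGroup.symplectic_det (SymplecticGroup.map_mem h f))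
    rw [fromBlocks_map] at hu
    obtain ⟨X, hX, hX2⟩ := exists_symmetric_X_invertible_add_mul_of_ker_inter_eq_bot
      (A := A.map f) (C := C.map f) (fun x hx1 hx2 => by
        rw [smul_eq_mulVec] at hx1 hx2
        have hv0 : fromBlocks (A.map f) (B.map f) (C.map f) (D.map f) *ᵥ (Sum.elim x 0) =
            fromBlocks (A.map f) (B.map f) (C.map f) (D.map f) *ᵥ (Sum.elim 0 0) := by
          simp [fromBlocks_mulVec, hx1, hx2]
        exact (Sum.elim_eq_iff.1 (mulVec_injective_iff_isUnit.2 hu hv0)).1) hm.1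
    exact ⟨X, hX, fun _ => hX2⟩
  choose X hX hX2 using hloc
  obtain ⟨Y, hY, hYX⟩ := exists_crt_symm n X hX
  refine ⟨Y.map (Int.castRingHom (ZMod n)), hY.map _, ?_⟩
  set d := (A + Y.map (Int.castRingHom (ZMod n)) * C).det with hd
  rw [← ZMod.natCast_zmod_val d, ZMod.isUnit_iff_coprime]
  refine Nat.Coprime.symm (Nat.coprime_of_dvd fun p hp hpn hpd => ?_)
  have hpm : p ∈ n.primeFactors := Nat.mem_primeFactors.2 ⟨hp, hpn, NeZero.ne n⟩
  have : Fact p.Prime := ⟨hp⟩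
  have hu := (Matrix.isUnit_iff_isUnit_det _).1 (hX2 p hpm)
  let f := ZMod.castHom hpn (ZMod p)
  have hfd : f d = 0 := by
    rw [← ZMod.natCast_zmod_val d, map_natCast]
    exact (ZMod.natCast_eq_zero_iff _ _).2 hpd
  apply hu.ne_zero
  rw [← hfd, hd, RingHom.map_det, map_add, map_mul, ← hYX p hpm]
  congr 3
  ext i j
  simp

theorem symplectic_le_spImg : symplecticGroup l (ZMod n) ≤ spImg l n := by
  intro M hM
  rw [← M.fromBlocks_toBlocks] at hM ⊢
  obtain ⟨X, hX, hu⟩ := exists_good_X n hM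
  have hXs : fromBlocks 1 X 0 1 ∈ symplecticGroup l (ZMod n) := by
    rw [SymplecticGroup.fromBlocks_mem_iff]
    simp [hX.eq]
  have h1 := mul_mem hXs hM
  rw [fromBlocks_multiply] at h1
  simp only [one_mul, zero_mul, zero_add] at h1
  have h2 := mul_mem (upper_mem n hX.neg) (mem_of_isUnit n h1 hu)
  rw [fromBlocks_multiply] at h2
  simpa using h2

end lift

theorem mem_spCong {g n : ℕ} (A : symplecticGroup (Fin g) ℤ) :
    A ∈ spCong g n ↔ A.1.map (Int.castRingHom (ZMod n)) = 1 := by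
  rw [spCong, MonoidHom.mem_ker, Units.ext_iff]
  rfl

theorem mem_spCong_dvd {g n : ℕ} (A : symplecticGroup (Fin g) ℤ) :
    A ∈ spCong g n ↔ ∀ i j, (n : ℤ) ∣ A.1 i j - (1 : Matrix _ _ ℤ) i j := by
  rw [mem_spCong, ← Matrix.ext_iff]
  refine forall_congr' fun i => forall_congr' fun j => ?_
  rw [← ZMod.intCast_zmod_eq_zero_iff_dvd, Int.cast_sub, sub_eq_zero]
  simp [Matrix.one_apply]

theorem spCong_mono {g a b : ℕ} (h : a ∣ b) : spCong g b ≤ spCong g a := by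
  intro A hA
  rw [mem_spCong_dvd] at hA ⊢
  exact fun i j => (Int.natCast_dvd_natCast.2 h).trans (hA i j)

theorem newman_smart (g ℓ m : ℕ) (hℓ : 0 < ℓ) (hm : 0 < m) (A : symplecticGroup (Fin g) ℤ)
    (hA : A ∈ spCong g (Nat.gcd ℓ m)) : ∃ B ∈ spCong g ℓ, B⁻¹ * A ∈ spCong g m := by
  have : NeZero (Nat.lcm ℓ m) := ⟨Nat.lcm_ne_zero hℓ.ne' hm.ne'⟩
  rw [mem_spCong_dvd] at hA
  have hC : ∀ i j, ∃ c : ℤ, (ℓ : ℤ) ∣ c - (1 : Matrix _ _ ℤ) i j ∧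
      (m : ℤ) ∣ c - A.1 i j := by
    intro i j
    obtain ⟨t, ht⟩ := hA i j
    rw [Nat.gcd_eq_gcd_ab] at ht
    refine ⟨(1 : Matrix _ _ ℤ) i j + ℓ * (Nat.gcdA ℓ m * t), ⟨Nat.gcdA ℓ m * t, by ring⟩,
      ⟨- (Nat.gcdB ℓ m * t), ?_⟩⟩
    linear_combination - ht
  choose C hC1 hC2 using hC
  let C' : Matrix (Fin g ⊕ Fin g) (Fin g ⊕ Fin g) ℤ := C
  have hCl : C'.map (Int.castRingHom (ZMod ℓ)) = 1 := by
    ext i j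
    have := (ZMod.intCast_zmod_eq_zero_iff_dvd _ _).2 (hC1 i j)
    rw [Int.cast_sub, sub_eq_zero] at this
    change ((C i j : ℤ) : ZMod ℓ) = _
    simpa [Matrix.one_apply] using this
  have hCm : C'.map (Int.castRingHom (ZMod m)) =
      A.1.map (Int.castRingHom (ZMod m)) := by
    ext i j
    have := (ZMod.intCast_zmod_eq_zero_iff_dvd _ _).2 (hC2 i j)
    rw [Int.cast_sub, sub_eq_zero] at this
    exact this
  have hform : ∀ (k : ℕ), C'.map (Int.castRingHom (ZMod k)) ∈ symplecticGroup (Fin g) (ZMod k) ↔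
      ∀ i j, (k : ℤ) ∣ (C' * J (Fin g) ℤ * C'ᵀ) i j - J (Fin g) ℤ i j := by
    intro k
    rw [SymplecticGroup.mem_iff, ← transpose_map, ← map_J _ (Int.castRingHom (ZMod k)),
      ← Matrix.map_mul, ← Matrix.map_mul, ← Matrix.ext_iff]
    refine forall_congr' fun i => forall_congr' fun j => ?_
    rw [← ZMod.intCast_zmod_eq_zero_iff_dvd, Int.cast_sub, sub_eq_zero]
    rfl
  have hsp : C'.map (Int.castRingHom (ZMod (Nat.lcm ℓ m))) ∈
      symplecticGroup (Fin g) (ZMod (Nat.lcm ℓ m)) := by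
    rw [hform]
    have h1 := (hform ℓ).1 (by rw [hCl]; exact one_mem _)
    have h2 := (hform m).1 (by rw [hCm]; exact SymplecticGroup.map_mem A.2 _)
    intro i j
    have := Int.coe_lcm_dvd (h1 i j) (h2 i j)
    simpa [Int.lcm] using this
  obtain ⟨B, hB, hBC⟩ := symplectic_le_spImg _ hsp
  have hBC' : ∀ i j, (Nat.lcm ℓ m : ℤ) ∣ B i j - C i j := by
    intro i j
    have := congrFun (congrFun hBC i) j
    rw [← ZMod.intCast_zmod_eq_zero_iff_dvd, Int.cast_sub, sub_eq_zero]
    exact this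
  refine ⟨⟨B, hB⟩, ?_, ?_⟩
  · rw [mem_spCong_dvd]
    intro i j
    have := dvd_add ((Int.natCast_dvd_natCast.2 (Nat.dvd_lcm_left ℓ m)).trans (hBC' i j)) (hC1 i j)
    simpa using this
  · rw [spCong, ← MonoidHom.eq_iff, Units.ext_iff]
    change A.1.map (Int.castRingHom (ZMod m)) = B.map (Int.castRingHom (ZMod m))
    ext i j
    have := dvd_sub ((Int.natCast_dvd_natCast.2 (Nat.dvd_lcm_right ℓ m)).trans (hBC' i j))
      (dvd_neg.2 (hC2 i j))
    have := (ZMod.intCast_zmod_eq_zero_iff_dvd _ _).2 this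
    push_cast at this
    simp only [map_apply, eq_intCast]
    linear_combination -this

theorem spCong_mul (g : ℕ) (ℓ m : ℕ) (hℓ : 0 < ℓ) (hm : 0 < m) :
    (spCong g ℓ : Set (Matrix.symplecticGroup (Fin g) ℤ)) *
        (spCong g m : Set (Matrix.symplecticGroup (Fin g) ℤ)) =
      (spCong g (Nat.gcd ℓ m) : Set (Matrix.symplecticGroup (Fin g) ℤ)) := by
  apply Set.Subset.antisymm
  · rintro _ ⟨a, ha, b, hb, rfl⟩
    exact mul_mem (spCong_mono (Nat.gcd_dvd_left ℓ m) ha) (spCong_mono (Nat.gcd_dvd_right ℓ m) hb)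
  · intro A hA
    obtain ⟨B, hB, hBA⟩ := newman_smart g ℓ m hℓ hm A hA
    exact ⟨B, hB, B⁻¹ * A, hBA, by simp⟩
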